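/- Let n ≥ 3. There is a constant C = C(n) such that for every continuous vector field A : ℝ^n → ℝ^n with ‖A‖_X < ∞ and every Schwartz function f on ℝ^n, ∫_{ℝ^n} ⟨x⟩^{2} ‖ t ↦ A(x)·(∇_x e^{itΔ}f)(x) ‖²_{H^{-1/4}(ℝ)} dx ≤ C ‖A‖²_X ‖f‖²_{L²(ℝ^n)}. (For each fixed x, the function t ↦ A(x)·(∇_x e^{itΔ}f)(x) belongs to L²(ℝ) since it decays like |t|^{-n/2}; the time variable t ranges over all of ℝ.) -/

import Mathlib

open MeasureTheory ENNReal SchwartzMap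

/-- The dyadic shell `D_j`: `D_0 = {|x| ≤ 1}`, and for `j ≥ 1`,
`D_j = {2^{j-1} < |x| ≤ 2^j}`. -/
noncomputable def shell (n j : ℕ) : Set (EuclideanSpace ℝ (Fin n)) :=
  if j = 0 then {x | ‖x‖ ≤ 1} else {x | (2 : ℝ) ^ (j - 1) < ‖x‖ ∧ ‖x‖ ≤ (2 : ℝ) ^ j}

/-- `‖A‖_X = (Σ_{j≥0} 2^{3j} ‖A‖_{L^∞(D_j)}²)^{1/2}` for a vector field `A`. -/
noncomputable def XnormV {n : ℕ} (A : EuclideanSpace ℝ (Fin n) → EuclideanSpace ℝ (Fin n)) :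
    ℝ≥0∞ :=
  (∑' j : ℕ, (2 : ℝ≥0∞) ^ (3 * j) *
    (eLpNorm A ⊤ (volume.restrict (shell n j))) ^ 2) ^ ((1 : ℝ) / 2)

/-- The free Schrödinger evolution `(e^{itΔ}f)(x)`, given for `t ≠ 0` by the
explicit convolution formula with the principal branch of the complex power. -/
noncomputable def schrod (n : ℕ) (t : ℝ) (f : EuclideanSpace ℝ (Fin n) → ℂ)
    (x : EuclideanSpace ℝ (Fin n)) : ℂ :=
  if t = 0 then f x
  else (4 * Real.pi * Complex.I * (t : ℂ)) ^ (-(n : ℂ) / 2) *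
    ∫ y : EuclideanSpace ℝ (Fin n),
      Complex.exp (Complex.I * (‖x - y‖ : ℂ) ^ 2 / (4 * (t : ℂ))) * f y

/-- The square of the `H^s(ℝ)` norm of `v : ℝ → ℂ`, defined via the Fourier
transform `v̂(λ) = ∫ e^{-itλ} v(t) dt`. -/
noncomputable def HnormSq (s : ℝ) (v : ℝ → ℂ) : ℝ≥0∞ :=
  ∫⁻ lam : ℝ, ENNReal.ofReal ((1 + lam ^ 2) ^ s) *
    (‖∫ t : ℝ, Complex.exp (-(Complex.I * (t : ℂ) * (lam : ℂ))) * v t‖₊ : ℝ≥0∞) ^ 2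

section GradientSmoothing

open Filter Topology RealInnerProductSpace ProbabilityTheory

section OscillatoryRepresentation

variable {V : Type*} [NormedAddCommGroup V] [InnerProductSpace ℝ V] [FiniteDimensional ℝ V]
  [MeasurableSpace V] [BorelSpace V]

/-- Parseval duality between the Fourier transform of `f` and a modulated Gaussian. -/
lemma integral_gaussian_mul_fourier {b : ℂ} (hb : 0 < b.re) {f : V → ℂ} (hf : Integrable f)
    (x : V) :
    ∫ ξ, Complex.exp (-b * ‖ξ‖ ^ 2 + 2 * Real.pi * Complex.I * ⟪x, ξ⟫) *
        FourierTransform.fourier f ξ =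
      (Real.pi / b) ^ (Module.finrank ℝ V / 2 : ℂ) *
        ∫ y, Complex.exp (-Real.pi ^ 2 * ‖x - y‖ ^ 2 / b) * f y := by
  have hg : Integrable fun ξ : V =>
      Complex.exp (-b * ‖ξ‖ ^ 2 + 2 * Real.pi * Complex.I * ⟪x, ξ⟫) :=
    GaussianFourier.integrable_cexp_neg_mul_sq_norm_add hb _ _
  have key := VectorFourier.integral_fourierIntegral_smul_eq_flip (L := innerₗ V)
    (μ := volume) (ν := volume) Real.continuous_fourierChar continuous_inner hg hf
  rw [flip_innerₗ] at key
  have h1 : ∀ w, VectorFourier.fourierIntegral Real.fourierChar volume (innerₗ V) (fun ξ : V =>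
      Complex.exp (-b * ‖ξ‖ ^ 2 + 2 * Real.pi * Complex.I * ⟪x, ξ⟫)) w =
      (Real.pi / b) ^ (Module.finrank ℝ V / 2 : ℂ) *
        Complex.exp (-Real.pi ^ 2 * ‖x - w‖ ^ 2 / b) :=
    fun w => fourier_gaussian_innerProductSpace' hb x w
  simp only [h1] at key
  simp only [smul_eq_mul, mul_assoc, integral_const_mul] at key
  simp only [mul_assoc]
  exact key.symm

/-- The gradient of an oscillatory integral with integrable first moment. -/
lemma hasFDerivAt_integral_exp_inner_mul {h : V → ℂ} (hh : Integrable h)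
    (hh' : Integrable fun ξ => ‖ξ‖ * ‖h ξ‖) (x : V) :
    HasFDerivAt (fun x => ∫ ξ, Complex.exp (2 * Real.pi * Complex.I * ⟪x, ξ⟫) * h ξ)
      (∫ ξ, (Complex.exp (2 * Real.pi * Complex.I * ⟪x, ξ⟫) * (2 * Real.pi * Complex.I) * h ξ) •
        (Complex.ofRealCLM.comp (innerSL ℝ ξ))) x := by
  have hm := hh.aestronglyMeasurable
  have hnorm : ∀ r : ℝ, ‖Complex.exp (2 * Real.pi * Complex.I * r)‖ = 1 := fun r => by
    rw [show (2 * Real.pi * Complex.I * r : ℂ) = ((2 * Real.pi * r : ℝ) : ℂ) * Complex.I by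
      push_cast; ring]
    exact Complex.norm_exp_ofReal_mul_I _
  refine hasFDerivAt_integral_of_dominated_of_fderiv_le (𝕜 := ℝ)
    (F' := fun (x ξ : V) => (Complex.exp (2 * Real.pi * Complex.I * ⟪x, ξ⟫) *
      (2 * Real.pi * Complex.I) * h ξ) • (Complex.ofRealCLM.comp (innerSL ℝ ξ)))
    (bound := fun ξ : V =>
    2 * Real.pi * (‖ξ‖ * ‖h ξ‖)) (s := Set.univ) Filter.univ_mem ?_ ?_ ?_ ?_ ?_ ?_
  · refine Eventually.of_forall fun y => AEStronglyMeasurable.mul ?_ hm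
    exact Continuous.aestronglyMeasurable (by fun_prop)
  · refine hh.bdd_mul (c := 1) (Continuous.aestronglyMeasurable (by fun_prop)) ?_
    exact Eventually.of_forall fun ξ => (hnorm _).le
  · refine AEStronglyMeasurable.smul (AEStronglyMeasurable.mul
      (Continuous.aestronglyMeasurable (by fun_prop)) hm)
      (Continuous.aestronglyMeasurable (by fun_prop))
  · refine Eventually.of_forall fun ξ y _ => ?_
    rw [norm_smul]
    have h2 : ‖Complex.ofRealCLM.comp (innerSL ℝ ξ)‖ ≤ ‖ξ‖ := by
      refine (ContinuousLinearMap.opNorm_comp_le _ _).trans ?_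
      simp
    rw [norm_mul, norm_mul, hnorm]
    have h3 : ‖(2 * Real.pi * Complex.I : ℂ)‖ = 2 * Real.pi := by
      simp [abs_of_pos Real.pi_pos]
    rw [h3]
    calc 1 * (2 * Real.pi) * ‖h ξ‖ * ‖Complex.ofRealCLM.comp (innerSL ℝ ξ)‖
        ≤ 1 * (2 * Real.pi) * ‖h ξ‖ * ‖ξ‖ := by gcongr
      _ = _ := by ring
  · exact hh'.const_mul _
  · refine Eventually.of_forall fun ξ y _ => ?_
    have h0 : HasFDerivAt (fun x : V => ((⟪x, ξ⟫ : ℝ) : ℂ))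
        (Complex.ofRealCLM.comp (innerSL ℝ ξ)) y := by
      have := (Complex.ofRealCLM.comp (innerSL ℝ ξ)).hasFDerivAt (x := y)
      refine this.congr_of_eventuallyEq (Eventually.of_forall fun z => ?_)
      simp [real_inner_comm]
    have h1 := ((h0.const_mul (2 * Real.pi * Complex.I : ℂ)).cexp).mul_const (h ξ)
    convert! h1 using 1
    ext v
    simp
    ring

lemma fderiv_integral_exp_inner_mul {h : V → ℂ} (hh : Integrable h)
    (hh' : Integrable fun ξ => ‖ξ‖ * ‖h ξ‖) (x v : V) :
    fderiv ℝ (fun x => ∫ ξ, Complex.exp (2 * Real.pi * Complex.I * ⟪x, ξ⟫) * h ξ) x v =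
      ∫ ξ, Complex.exp (2 * Real.pi * Complex.I * ⟪x, ξ⟫) *
        (2 * Real.pi * Complex.I * ⟪ξ, v⟫ * h ξ) := by
  rw [(hasFDerivAt_integral_exp_inner_mul hh hh' x).fderiv, ContinuousLinearMap.integral_apply]
  · refine integral_congr_ae (Eventually.of_forall fun ξ => ?_)
    simp
    ring
  · have hm := hh.aestronglyMeasurable
    refine (hh'.const_mul (2 * Real.pi)).mono' (AEStronglyMeasurable.smul
      (AEStronglyMeasurable.mul (Continuous.aestronglyMeasurable (by fun_prop)) hm)
      (Continuous.aestronglyMeasurable (by fun_prop))) (Eventually.of_forall fun ξ => ?_)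
    rw [norm_smul]
    have h2 : ‖Complex.ofRealCLM.comp (innerSL ℝ ξ)‖ ≤ ‖ξ‖ := by
      refine (ContinuousLinearMap.opNorm_comp_le _ _).trans ?_
      simp
    have h4 : ‖Complex.exp (2 * Real.pi * Complex.I * (⟪x, ξ⟫ : ℝ))‖ = 1 := by
      rw [show (2 * Real.pi * Complex.I * (⟪x, ξ⟫ : ℝ) : ℂ) =
        ((2 * Real.pi * ⟪x, ξ⟫ : ℝ) : ℂ) * Complex.I by push_cast; ring]
      exact Complex.norm_exp_ofReal_mul_I _
    have h3 : ‖(2 * Real.pi * Complex.I : ℂ)‖ = 2 * Real.pi := by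
      simp [abs_of_pos Real.pi_pos]
    rw [norm_mul, norm_mul, h4, h3]
    calc 1 * (2 * Real.pi) * ‖h ξ‖ * ‖Complex.ofRealCLM.comp (innerSL ℝ ξ)‖
        ≤ 1 * (2 * Real.pi) * ‖h ξ‖ * ‖ξ‖ := by gcongr
      _ = _ := by ring

end OscillatoryRepresentation

/-- The free evolution as an oscillatory integral on the Fourier side. -/
lemma schrod_eq_integral_fourier {n : ℕ} {t : ℝ} (ht : t ≠ 0)
    (f : 𝓢(EuclideanSpace ℝ (Fin n), ℂ)) (x : EuclideanSpace ℝ (Fin n)) :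
    schrod n t f x = ∫ ξ, Complex.exp (2 * Real.pi * Complex.I * ⟪x, ξ⟫) *
      (Complex.exp (-(4 * Real.pi ^ 2 * t * Complex.I) * ‖ξ‖ ^ 2) *
        FourierTransform.fourier f ξ) := by
  have hpi : (Real.pi : ℂ) ≠ 0 := by exact_mod_cast Real.pi_ne_zero
  have htc : (t : ℂ) ≠ 0 := by exact_mod_cast ht
  set c : ℂ := 4 * Real.pi ^ 2 * t * Complex.I with hc
  have hc0 : c ≠ 0 := by simp [hc, hpi, htc]
  have hcre : c.re = 0 := by
    rw [show c = ((4 * Real.pi ^ 2 * t : ℝ) : ℂ) * Complex.I by push_cast; rfl]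
    rw [Complex.re_ofReal_mul, Complex.I_re, mul_zero]
  have hcim : c.im ≠ 0 := by
    rw [show c = ((4 * Real.pi ^ 2 * t : ℝ) : ℂ) * Complex.I by push_cast; rfl]
    rw [Complex.im_ofReal_mul, Complex.I_im, mul_one]
    have := Real.pi_pos
    positivity
  set b : ℕ → ℂ := fun k => c + ((1 / ((k : ℝ) + 1) : ℝ) : ℂ) with hbdef
  have hbre : ∀ k, 0 < (b k).re := fun k => by
    simp only [hbdef, Complex.add_re, hcre, Complex.ofReal_re, zero_add]
    positivity
  have hblim : Tendsto b atTop (𝓝 c) := by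
    have : Tendsto (fun k : ℕ => ((1 / ((k : ℝ) + 1) : ℝ) : ℂ)) atTop (𝓝 ((0 : ℝ) : ℂ)) :=
      (Complex.continuous_ofReal.tendsto 0).comp tendsto_one_div_add_atTop_nhds_zero_nat
    convert! this.const_add c using 2
    simp
  have hphase : ∀ r : ℝ, ‖Complex.exp (2 * Real.pi * Complex.I * r)‖ = 1 := fun r => by
    rw [show (2 * Real.pi * Complex.I * r : ℂ) = ((2 * Real.pi * r : ℝ) : ℂ) * Complex.I by
      push_cast; ring]
    exact Complex.norm_exp_ofReal_mul_I _
  have hfi := f.integrable (μ := volume)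
  have hFi := (FourierTransform.fourier f).integrable (μ := volume)
  have hL : Tendsto (fun k => ∫ ξ, Complex.exp (-b k * ‖ξ‖ ^ 2 +
      2 * Real.pi * Complex.I * ⟪x, ξ⟫) * FourierTransform.fourier f ξ) atTop
      (𝓝 (∫ ξ, Complex.exp (2 * Real.pi * Complex.I * ⟪x, ξ⟫) *
      (Complex.exp (-c * ‖ξ‖ ^ 2) * FourierTransform.fourier f ξ))) := by
    refine tendsto_integral_of_dominated_convergence
      (fun ξ => ‖FourierTransform.fourier f ξ‖) (fun k => ?_) hFi.norm (fun k => ?_) ?_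
    · exact AEStronglyMeasurable.mul (Continuous.aestronglyMeasurable (by fun_prop))
        hFi.aestronglyMeasurable
    · refine Eventually.of_forall fun ξ => ?_
      rw [norm_mul, Complex.exp_add, norm_mul, hphase, mul_one, Complex.norm_exp]
      refine mul_le_of_le_one_left (norm_nonneg _) ?_
      rw [Real.exp_le_one_iff]
      have : (-b k * (‖ξ‖ : ℂ) ^ 2).re = -((b k).re * ‖ξ‖ ^ 2) := by
        rw [← Complex.ofReal_pow, Complex.re_mul_ofReal]
        simp
      rw [this]
      have := mul_nonneg (hbre k).le (sq_nonneg ‖ξ‖)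
      linarith
    · refine Eventually.of_forall fun ξ => ?_
      have h1 : Tendsto (fun k => Complex.exp (-b k * ‖ξ‖ ^ 2 +
          2 * Real.pi * Complex.I * ⟪x, ξ⟫) * FourierTransform.fourier f ξ) atTop
          (𝓝 (Complex.exp (-c * ‖ξ‖ ^ 2 +
          2 * Real.pi * Complex.I * ⟪x, ξ⟫) * FourierTransform.fourier f ξ)) :=
        ((Complex.continuous_exp.tendsto _).comp
          ((hblim.neg.mul_const _).add_const _)).mul_const _
      convert! h1 using 2
      rw [Complex.exp_add]
      ring
  have hR : Tendsto (fun k => (Real.pi / b k) ^ (Module.finrank ℝ (EuclideanSpace ℝ (Fin n)) /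
      2 : ℂ) * ∫ y, Complex.exp (-Real.pi ^ 2 * ‖x - y‖ ^ 2 / b k) * f y) atTop
      (𝓝 ((Real.pi / c) ^ (Module.finrank ℝ (EuclideanSpace ℝ (Fin n)) /
      2 : ℂ) * ∫ y, Complex.exp (-Real.pi ^ 2 * ‖x - y‖ ^ 2 / c) * f y)) := by
    refine Tendsto.mul ?_ ?_
    · refine Tendsto.cpow (tendsto_const_nhds.div hblim hc0) tendsto_const_nhds ?_
      rw [Complex.mem_slitPlane_iff]
      right
      rw [Complex.div_im]
      simp [hcre, hcim, hc0]
    · refine tendsto_integral_of_dominated_convergence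
        (fun y => ‖f y‖) (fun k => ?_) hfi.norm (fun k => ?_) ?_
      · exact AEStronglyMeasurable.mul (Continuous.aestronglyMeasurable (by fun_prop))
          hfi.aestronglyMeasurable
      · refine Eventually.of_forall fun y => ?_
        rw [norm_mul, Complex.norm_exp]
        refine mul_le_of_le_one_left (norm_nonneg _) ?_
        rw [Real.exp_le_one_iff]
        rw [show (-Real.pi ^ 2 * ‖x - y‖ ^ 2 / b k : ℂ) =
          ((-Real.pi ^ 2 * ‖x - y‖ ^ 2 : ℝ) : ℂ) / b k by push_cast; rfl, Complex.div_re]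
        simp only [Complex.ofReal_re, Complex.ofReal_im, zero_mul, zero_div, add_zero]
        refine div_nonpos_of_nonpos_of_nonneg ?_ (Complex.normSq_nonneg _)
        have := mul_nonneg (mul_nonneg (sq_nonneg Real.pi) (sq_nonneg ‖x - y‖)) (hbre k).le
        linarith
      · refine Eventually.of_forall fun y => ?_
        exact ((Complex.continuous_exp.tendsto _).comp
          (tendsto_const_nhds.div hblim hc0)).mul_const _
  have hEq : ∀ k, ∫ ξ, Complex.exp (-b k * ‖ξ‖ ^ 2 +
      2 * Real.pi * Complex.I * ⟪x, ξ⟫) * FourierTransform.fourier f ξ = _ := fun k =>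
    integral_gaussian_mul_fourier (hbre k) hfi x
  rw [tendsto_nhds_unique hL (hR.congr fun k => (hEq k).symm)]
  rw [schrod, if_neg ht]
  congr 1
  · have h1 : (Real.pi / c : ℂ) = (4 * Real.pi * Complex.I * t)⁻¹ := by
      rw [hc]
      field_simp
    have hz : (4 * Real.pi * Complex.I * t : ℂ) = ((4 * Real.pi * t : ℝ) : ℂ) * Complex.I := by
      push_cast; ring
    rw [h1, Complex.inv_cpow, ← Complex.cpow_neg, neg_div]
    · simp
    · rw [hz]
      intro h
      have := (Complex.arg_eq_pi_iff.mp h).1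
      simp at this
  · refine integral_congr_ae (Eventually.of_forall fun y => ?_)
    simp only []
    congr 2
    rw [hc]
    field_simp
    simp

/-- The `i`-th partial derivative of the free evolution, as an oscillatory integral. -/
lemma fderiv_schrod {n : ℕ} {t : ℝ} (ht : t ≠ 0)
    (f : 𝓢(EuclideanSpace ℝ (Fin n), ℂ)) (x : EuclideanSpace ℝ (Fin n)) (i : Fin n) :
    fderiv ℝ (fun y => schrod n t f y) x (EuclideanSpace.single i 1) =
      ∫ ξ, Complex.exp (2 * Real.pi * Complex.I * ⟪x, ξ⟫) *
        (2 * Real.pi * Complex.I * (ξ i : ℝ) *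
          (Complex.exp (-(4 * Real.pi ^ 2 * t * Complex.I) * ‖ξ‖ ^ 2) *
          FourierTransform.fourier f ξ)) := by
  have hFi := (FourierTransform.fourier f).integrable (μ := volume)
  have hFi' := (FourierTransform.fourier f).integrable_pow_mul volume 1
  have hn : ∀ ξ : EuclideanSpace ℝ (Fin n),
      ‖Complex.exp (-(4 * Real.pi ^ 2 * t * Complex.I) * ‖ξ‖ ^ 2)‖ = 1 := fun ξ => by
    rw [show (-(4 * Real.pi ^ 2 * t * Complex.I) * ‖ξ‖ ^ 2 : ℂ) =
      ((-(4 * Real.pi ^ 2 * t * ‖ξ‖ ^ 2) : ℝ) : ℂ) * Complex.I by push_cast; ring]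
    exact Complex.norm_exp_ofReal_mul_I _
  simp_rw [schrod_eq_integral_fourier ht f]
  rw [fderiv_integral_exp_inner_mul]
  · simp [EuclideanSpace.inner_single_right]
  · refine hFi.bdd_mul (c := 1) (Continuous.aestronglyMeasurable (by fun_prop)) ?_
    exact Eventually.of_forall fun ξ => (hn ξ).le
  · simpa only [norm_mul, hn, one_mul, pow_one] using hFi'

lemma integral_exp_mul_gaussian {v : NNReal} (hv : v ≠ 0) (s : ℝ) :
    ∫ t : ℝ, Complex.exp (-(Complex.I * (t : ℂ) * (s : ℂ))) *
      Complex.exp (-((v : ℝ) / 2 : ℂ) * (t : ℂ) ^ 2) = 2 * Real.pi * (gaussianPDFReal 0 v s : ℝ) := by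
  have hv' : 0 < (v : ℝ) := by positivity
  have hb : 0 < (((v : ℝ) / 2 : ℝ) : ℂ).re := by
    rw [Complex.ofReal_re]; positivity
  have h := fourierIntegral_gaussian hb (-s)
  have h1 : (∫ t : ℝ, Complex.exp (-(Complex.I * (t : ℂ) * (s : ℂ))) *
      Complex.exp (-((v : ℝ) / 2 : ℂ) * (t : ℂ) ^ 2)) = ∫ x : ℝ, Complex.exp (Complex.I * -s * x) *
      Complex.exp (-(((v : ℝ) / 2 : ℝ) : ℂ) * (x : ℂ) ^ 2) := by
    refine integral_congr_ae (Eventually.of_forall fun t => ?_)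
    simp only []
    congr 2
    · ring
    · push_cast; ring
  rw [h1, h, gaussianPDFReal]
  have h2 : (Real.pi / (((v : ℝ) / 2 : ℝ) : ℂ)) ^ (1 / 2 : ℂ) =
      ((2 * Real.pi * (√(2 * Real.pi * v))⁻¹ : ℝ) : ℂ) := by
    rw [← Complex.ofReal_div, show (1 / 2 : ℂ) = ((1 / 2 : ℝ) : ℂ) by push_cast; rfl,
      ← Complex.ofReal_cpow (by positivity), ← Real.sqrt_eq_rpow]
    congr 1
    rw [Real.sqrt_eq_iff_mul_self_eq (by positivity) (by positivity)]
    have := Real.mul_self_sqrt (show 0 ≤ 2 * Real.pi * (v : ℝ) by positivity)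
    field_simp
    rw [Real.sq_sqrt (by positivity)]
  rw [h2]
  push_cast
  rw [mul_assoc, mul_assoc, mul_assoc, mul_assoc]
  congr 4
  field_simp
  ring

/-- The oscillatory integral obtained from a time-regularised Fourier transform. -/
noncomputable def mollifiedWave {n : ℕ} (v : NNReal) (i : Fin n)
    (φ : EuclideanSpace ℝ (Fin n) → ℂ) (x : EuclideanSpace ℝ (Fin n)) (lam : ℝ) : ℂ :=
  ∫ ξ, Complex.exp (2 * Real.pi * Complex.I * ⟪x, ξ⟫) *
    ((gaussianPDFReal 0 v (lam + 4 * Real.pi ^ 2 * ‖ξ‖ ^ 2) * ξ i : ℝ) * φ ξ)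

section Regularisation

variable {n : ℕ} (f : 𝓢(EuclideanSpace ℝ (Fin n), ℂ)) (x : EuclideanSpace ℝ (Fin n)) (i : Fin n)
  (lam : ℝ)

lemma integrable_time_regularised {v : NNReal} (hv : v ≠ 0) :
    Integrable (Function.uncurry fun (t : ℝ) (ξ : EuclideanSpace ℝ (Fin n)) =>
      Complex.exp (-(Complex.I * (t : ℂ) * (lam : ℂ))) *
      Complex.exp (-((v : ℝ) / 2 : ℂ) * (t : ℂ) ^ 2) *
      (Complex.exp (2 * Real.pi * Complex.I * ⟪x, ξ⟫) *
        (2 * Real.pi * Complex.I * (ξ i : ℝ) *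
          (Complex.exp (-(4 * Real.pi ^ 2 * t * Complex.I) * ‖ξ‖ ^ 2) *
          FourierTransform.fourier f ξ)))) := by
  have hv' : 0 < (v : ℝ) := by positivity
  have hF' := (FourierTransform.fourier f).integrable_pow_mul volume 1
  have hg := integrable_exp_neg_mul_sq (b := (v : ℝ) / 2) (by positivity)
  refine ((hg.const_mul (2 * Real.pi)).mul_prod hF').mono' ?_ (Eventually.of_forall ?_)
  · have := (FourierTransform.fourier f).continuous
    refine Continuous.aestronglyMeasurable ?_
    unfold Function.uncurry
    fun_prop
  · rintro ⟨t, ξ⟩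
    simp only [Function.uncurry_apply_pair, norm_mul]
    have e1 : ‖Complex.exp (-(Complex.I * (t : ℂ) * (lam : ℂ)))‖ = 1 := by
      rw [show (-(Complex.I * (t : ℂ) * (lam : ℂ))) = ((-(t * lam) : ℝ) : ℂ) * Complex.I by
        push_cast; ring]
      exact Complex.norm_exp_ofReal_mul_I _
    have e2 : ‖Complex.exp (2 * Real.pi * Complex.I * (⟪x, ξ⟫ : ℝ))‖ = 1 := by
      rw [show (2 * Real.pi * Complex.I * (⟪x, ξ⟫ : ℝ) : ℂ) =
        ((2 * Real.pi * ⟪x, ξ⟫ : ℝ) : ℂ) * Complex.I by push_cast; ring]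
      exact Complex.norm_exp_ofReal_mul_I _
    have e3 : ‖Complex.exp (-(4 * Real.pi ^ 2 * t * Complex.I) * ‖ξ‖ ^ 2)‖ = 1 := by
      rw [show (-(4 * Real.pi ^ 2 * t * Complex.I) * ‖ξ‖ ^ 2 : ℂ) =
        ((-(4 * Real.pi ^ 2 * t * ‖ξ‖ ^ 2) : ℝ) : ℂ) * Complex.I by push_cast; ring]
      exact Complex.norm_exp_ofReal_mul_I _
    have e4 : ‖Complex.exp (-((v : ℝ) / 2 : ℂ) * (t : ℂ) ^ 2)‖ =
        Real.exp (-((v : ℝ) / 2) * t ^ 2) := by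
      rw [show (-((v : ℝ) / 2 : ℂ) * (t : ℂ) ^ 2) = ((-((v : ℝ) / 2) * t ^ 2 : ℝ) : ℂ) by
        push_cast; ring, Complex.norm_exp, Complex.ofReal_re]
    rw [e1, e2, e3, e4]
    have e5 : ‖((ξ i : ℝ) : ℂ)‖ ≤ ‖ξ‖ := by
      rw [Complex.norm_real]
      exact PiLp.norm_apply_le ξ i
    have e6 : ‖(2 : ℂ)‖ * ‖(Real.pi : ℂ)‖ * ‖Complex.I‖ = 2 * Real.pi := by
      simp [abs_of_pos Real.pi_pos]
    rw [e6]
    calc _ = 2 * Real.pi * Real.exp (-((v : ℝ) / 2) * t ^ 2) *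
          (‖((ξ i : ℝ) : ℂ)‖ * ‖FourierTransform.fourier f ξ‖) := by ring
      _ ≤ 2 * Real.pi * Real.exp (-((v : ℝ) / 2) * t ^ 2) *
          (‖ξ‖ ^ 1 * ‖FourierTransform.fourier f ξ‖) := by
          rw [pow_one]; gcongr

lemma integrable_regularised_fderiv_schrod {v : NNReal} (hv : v ≠ 0) :
    Integrable fun t : ℝ => Complex.exp (-(Complex.I * (t : ℂ) * (lam : ℂ))) *
      Complex.exp (-((v : ℝ) / 2 : ℂ) * (t : ℂ) ^ 2) *
      fderiv ℝ (fun y => schrod n t f y) x (EuclideanSpace.single i 1) := by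
  refine (integrable_time_regularised f x i lam hv).integral_prod_left.congr ?_
  filter_upwards [Measure.ae_ne volume (0 : ℝ)] with t ht
  simp only [Function.uncurry_apply_pair, integral_const_mul]
  rw [fderiv_schrod ht]

lemma integral_regularised_fderiv_schrod {v : NNReal} (hv : v ≠ 0) :
    ∫ t : ℝ, Complex.exp (-(Complex.I * (t : ℂ) * (lam : ℂ))) *
      Complex.exp (-((v : ℝ) / 2 : ℂ) * (t : ℂ) ^ 2) *
      fderiv ℝ (fun y => schrod n t f y) x (EuclideanSpace.single i 1) =
    4 * Real.pi ^ 2 * Complex.I *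
      mollifiedWave v i (FourierTransform.fourier f : 𝓢(EuclideanSpace ℝ (Fin n), ℂ)) x lam := by
  have h1 : (∫ t : ℝ, Complex.exp (-(Complex.I * (t : ℂ) * (lam : ℂ))) *
      Complex.exp (-((v : ℝ) / 2 : ℂ) * (t : ℂ) ^ 2) *
      fderiv ℝ (fun y => schrod n t f y) x (EuclideanSpace.single i 1)) =
      ∫ t : ℝ, ∫ ξ : EuclideanSpace ℝ (Fin n),
      Complex.exp (-(Complex.I * (t : ℂ) * (lam : ℂ))) *
      Complex.exp (-((v : ℝ) / 2 : ℂ) * (t : ℂ) ^ 2) *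
      (Complex.exp (2 * Real.pi * Complex.I * ⟪x, ξ⟫) *
        (2 * Real.pi * Complex.I * (ξ i : ℝ) *
          (Complex.exp (-(4 * Real.pi ^ 2 * t * Complex.I) * ‖ξ‖ ^ 2) *
          FourierTransform.fourier f ξ))) := by
    refine integral_congr_ae ?_
    filter_upwards [Measure.ae_ne volume (0 : ℝ)] with t ht
    rw [fderiv_schrod ht, integral_const_mul]
  rw [h1, integral_integral_swap (integrable_time_regularised f x i lam hv), mollifiedWave,
    ← integral_const_mul]
  refine integral_congr_ae (Eventually.of_forall fun ξ => ?_)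
  have h2 := integral_exp_mul_gaussian hv (lam + 4 * Real.pi ^ 2 * ‖ξ‖ ^ 2)
  calc _ = ∫ t : ℝ, (Complex.exp (-(Complex.I * (t : ℂ) *
        ((lam + 4 * Real.pi ^ 2 * ‖ξ‖ ^ 2 : ℝ) : ℂ))) *
        Complex.exp (-((v : ℝ) / 2 : ℂ) * (t : ℂ) ^ 2)) *
        (Complex.exp (2 * Real.pi * Complex.I * ⟪x, ξ⟫) *
        (2 * Real.pi * Complex.I * (ξ i : ℝ) * FourierTransform.fourier f ξ)) := by
        refine integral_congr_ae (Eventually.of_forall fun t => ?_)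
        simp only []
        have : Complex.exp (-(Complex.I * (t : ℂ) *
            ((lam + 4 * Real.pi ^ 2 * ‖ξ‖ ^ 2 : ℝ) : ℂ))) =
            Complex.exp (-(Complex.I * (t : ℂ) * (lam : ℂ))) *
            Complex.exp (-(4 * Real.pi ^ 2 * t * Complex.I) * ‖ξ‖ ^ 2) := by
          rw [← Complex.exp_add]
          congr 1
          push_cast
          ring
        rw [this]
        ring
    _ = _ := by
        rw [integral_mul_const, h2]
        push_cast
        ring

end Regularisation

/-- The Fourier transform of `g` is controlled by its Gaussian regularisations (also when `g` is
not integrable, in which case the left side vanishes by convention). -/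
lemma enorm_integral_sq_le_liminf (g : ℝ → ℂ) (v : ℕ → NNReal) (hv : Tendsto v atTop (𝓝 0))
    (lam : ℝ) :
    ‖∫ t : ℝ, Complex.exp (-(Complex.I * (t : ℂ) * (lam : ℂ))) * g t‖ₑ ^ 2 ≤
      liminf (fun k => ‖∫ t : ℝ, Complex.exp (-(Complex.I * (t : ℂ) * (lam : ℂ))) *
        Complex.exp (-((v k : ℝ) / 2 : ℂ) * (t : ℂ) ^ 2) * g t‖ₑ ^ 2) atTop := by
  by_cases hg : Integrable fun t : ℝ => Complex.exp (-(Complex.I * (t : ℂ) * (lam : ℂ))) * g t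
  · have h1 : Tendsto (fun k => ∫ t : ℝ, Complex.exp (-((v k : ℝ) / 2 : ℂ) * (t : ℂ) ^ 2) *
        (Complex.exp (-(Complex.I * (t : ℂ) * (lam : ℂ))) * g t)) atTop
        (𝓝 (∫ t : ℝ, Complex.exp (-(Complex.I * (t : ℂ) * (lam : ℂ))) * g t)) := by
      refine tendsto_integral_of_dominated_convergence _ (fun k => ?_) hg.norm (fun k => ?_) ?_
      · exact AEStronglyMeasurable.mul (Continuous.aestronglyMeasurable (by fun_prop))
          hg.aestronglyMeasurable
      · refine Eventually.of_forall fun t => ?_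
        rw [norm_mul]
        refine mul_le_of_le_one_left (norm_nonneg _) ?_
        rw [show (-((v k : ℝ) / 2 : ℂ) * (t : ℂ) ^ 2) = ((-((v k : ℝ) / 2 * t ^ 2) : ℝ) : ℂ) by
          push_cast; ring, Complex.norm_exp, Complex.ofReal_re, Real.exp_le_one_iff,
          neg_nonpos]
        positivity
      · refine Eventually.of_forall fun t => ?_
        have h2 : Tendsto (fun k => ((v k : ℝ) : ℂ)) atTop (𝓝 ((0 : ℝ) : ℂ)) :=
          (Complex.continuous_ofReal.tendsto 0).comp
            ((NNReal.continuous_coe.tendsto 0).comp hv)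
        have h3 := ((Complex.continuous_exp.tendsto _).comp
          ((h2.div_const 2).neg.mul_const ((t : ℂ) ^ 2))).mul_const
          (Complex.exp (-(Complex.I * (t : ℂ) * (lam : ℂ))) * g t)
        convert! h3 using 2
        simp
    have h4 := ((ENNReal.continuous_pow 2).tendsto _).comp (h1.enorm)
    rw [← h4.liminf_eq]
    refine le_of_eq ?_
    congr 1
    ext k
    simp only [Function.comp]
    congr 3
    ext t
    ring
  · rw [integral_undef hg]
    simp

lemma lintegral_gaussian_mul_enorm_sq_le {V : Type*} [NormedAddCommGroup V]
    [InnerProductSpace ℝ V] [FiniteDimensional ℝ V] [MeasurableSpace V] [BorelSpace V]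
    {h : V → ℂ} (hh : Integrable h) {R : ℝ} (hR : 0 < R) :
    ∫⁻ x : V, ENNReal.ofReal (Real.exp (-(Real.pi / R ^ 2) * ‖x‖ ^ 2)) *
      ‖∫ ξ, Complex.exp (2 * Real.pi * Complex.I * ⟪x, ξ⟫) * h ξ‖ₑ ^ 2 ≤
    ∫⁻ p : V × V, ENNReal.ofReal (R ^ Module.finrank ℝ V *
      Real.exp (-(Real.pi * R ^ 2) * ‖p.1 - p.2‖ ^ 2)) * (‖h p.1‖ₑ * ‖h p.2‖ₑ) := by
  have hb : 0 < Real.pi / R ^ 2 := by have := Real.pi_pos; positivity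
  set b : ℝ := Real.pi / R ^ 2 with hbdef
  have hphase : ∀ r : ℝ, ‖Complex.exp (2 * Real.pi * Complex.I * r)‖ = 1 := fun r => by
    rw [show (2 * Real.pi * Complex.I * r : ℂ) = ((2 * Real.pi * r : ℝ) : ℂ) * Complex.I by
      push_cast; ring]
    exact Complex.norm_exp_ofReal_mul_I _
  set H : V → V → ℂ := fun x ξ => Complex.exp (2 * Real.pi * Complex.I * ⟪x, ξ⟫) * h ξ with hH
  have hHint : ∀ x, Integrable (H x) := fun x =>
    hh.bdd_mul (c := 1) (Continuous.aestronglyMeasurable (by fun_prop))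
      (Eventually.of_forall fun ξ => (hphase _).le)
  set W : V → ℂ := fun x => ∫ ξ, H x ξ with hW
  set Φ : V → V × V → ℂ := fun x p => (Real.exp (-b * ‖x‖ ^ 2) : ℂ) *
    (Complex.exp (2 * Real.pi * Complex.I * ⟪x, p.1⟫) *
      (starRingEnd ℂ) (Complex.exp (2 * Real.pi * Complex.I * ⟪x, p.2⟫)) *
      (h p.1 * (starRingEnd ℂ) (h p.2))) with hΦ
  have hw : Integrable fun x : V => Real.exp (-b * ‖x‖ ^ 2) := by
    have := (GaussianFourier.integrable_cexp_neg_mul_sq_norm_add (V := V) (b := (b : ℂ))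
      (by simpa using hb) 0 0).norm
    refine this.congr (Eventually.of_forall fun x => ?_)
    simp only [Complex.norm_exp]
    congr 1
    rw [zero_mul, add_zero, ← Complex.ofReal_pow, ← Complex.ofReal_neg, ← Complex.ofReal_mul,
      Complex.ofReal_re]
  have hhh : Integrable fun p : V × V => h p.1 * (starRingEnd ℂ) (h p.2) :=
    hh.mul_prod ((Complex.conjCLE.integrable_comp_iff (φ := h)).2 hh)
  have hΦint : Integrable (Function.uncurry Φ) (volume.prod volume) := by
    refine (hw.mul_prod hhh.norm).mono' ?_ (Eventually.of_forall ?_)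
    · refine AEStronglyMeasurable.mul ?_ (AEStronglyMeasurable.mul ?_ ?_)
      · exact Continuous.aestronglyMeasurable (by fun_prop)
      · exact Continuous.aestronglyMeasurable (by fun_prop)
      · exact hhh.aestronglyMeasurable.comp_snd
    · rintro ⟨x, p⟩
      simp only [Function.uncurry_apply_pair, hΦ, norm_mul, hphase, RCLike.norm_conj,
        Complex.norm_real, Real.norm_eq_abs, Real.abs_exp, one_mul, le_refl]
  have hS : ∀ x, ((Real.exp (-b * ‖x‖ ^ 2) * ‖W x‖ ^ 2 : ℝ) : ℂ) = ∫ p, Φ x p := fun x => by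
    have h1 : ∫ p : V × V, H x p.1 * (starRingEnd ℂ) (H x p.2) =
        W x * ∫ η, (starRingEnd ℂ) (H x η) :=
      integral_prod_mul (L := ℂ) (H x) (fun η => (starRingEnd ℂ) (H x η))
    rw [integral_conj] at h1
    rw [hΦ, integral_const_mul]
    rw [Complex.ofReal_mul]
    congr 1
    rw [Complex.ofReal_pow, ← Complex.mul_conj', ← h1]
    refine integral_congr_ae (Eventually.of_forall fun p => ?_)
    simp only [hH, map_mul]
    ring
  have hSint : Integrable fun x => Real.exp (-b * ‖x‖ ^ 2) * ‖W x‖ ^ 2 := by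
    have := hΦint.integral_prod_left
    simp only [Function.uncurry_apply_pair, ← hS] at this
    exact this.re.congr (Eventually.of_forall fun x => Complex.ofReal_re _)
  have hG : ∀ p : V × V, ‖∫ x, Φ x p‖ₑ = ENNReal.ofReal (R ^ Module.finrank ℝ V *
      Real.exp (-(Real.pi * R ^ 2) * ‖p.1 - p.2‖ ^ 2)) * (‖h p.1‖ₑ * ‖h p.2‖ₑ) := fun p => by
    have h1 : ∀ x, Φ x p = Complex.exp (-b * ‖x‖ ^ 2 +
        2 * Real.pi * Complex.I * ⟪p.1 - p.2, x⟫) * (h p.1 * (starRingEnd ℂ) (h p.2)) := fun x => by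
      simp only [hΦ]
      rw [← Complex.exp_conj, ← Complex.exp_add, ← mul_assoc, Complex.ofReal_exp,
        ← Complex.exp_add]
      congr 2
      rw [inner_sub_left, real_inner_comm, real_inner_comm x p.2]
      simp only [map_mul, Complex.conj_ofReal, Complex.conj_I, map_ofNat]
      push_cast
      ring
    simp only [h1]
    rw [integral_mul_const, GaussianFourier.integral_cexp_neg_mul_sq_norm_add (by simpa using hb),
      enorm_mul]
    congr 1
    · rw [← ofReal_norm]
      congr 1
      rw [norm_mul]
      congr 1
      · rw [show (Real.pi / b : ℂ) = ((R ^ 2 : ℝ) : ℂ) by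
          rw [hbdef]; push_cast
          have : (Real.pi : ℂ) ≠ 0 := by exact_mod_cast Real.pi_ne_zero
          field_simp,
          show (Module.finrank ℝ V / 2 : ℂ) = ((Module.finrank ℝ V / 2 : ℝ) : ℂ) by push_cast; rfl,
          ← Complex.ofReal_cpow (by positivity), Complex.norm_real, Real.norm_eq_abs,
          abs_of_nonneg (by positivity), ← Real.rpow_natCast R 2, ← Real.rpow_mul hR.le,
          ← Real.rpow_natCast]
        congr 1
        push_cast
        ring
      · rw [Complex.norm_exp]
        congr 1
        rw [show ((2 * Real.pi * Complex.I) ^ 2 * ‖p.1 - p.2‖ ^ 2 / (4 * b) : ℂ) =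
          ((-(Real.pi * R ^ 2) * ‖p.1 - p.2‖ ^ 2 : ℝ) : ℂ) by
            have : (Real.pi : ℂ) ≠ 0 := by exact_mod_cast Real.pi_ne_zero
            have hRc : (R : ℂ) ≠ 0 := by exact_mod_cast hR.ne'
            rw [hbdef]
            push_cast
            field_simp
            rw [Complex.I_sq]
            ring, Complex.ofReal_re]
    · rw [enorm_mul, ← ofReal_norm ((starRingEnd ℂ) (h p.2)), RCLike.norm_conj, ofReal_norm]
  calc ∫⁻ x : V, ENNReal.ofReal (Real.exp (-b * ‖x‖ ^ 2)) * ‖W x‖ₑ ^ 2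
      = ∫⁻ x : V, ENNReal.ofReal (Real.exp (-b * ‖x‖ ^ 2) * ‖W x‖ ^ 2) := by
        refine lintegral_congr fun x => ?_
        rw [ENNReal.ofReal_mul (Real.exp_pos _).le, ENNReal.ofReal_pow (norm_nonneg _), ofReal_norm]
    _ = ENNReal.ofReal (∫ x, Real.exp (-b * ‖x‖ ^ 2) * ‖W x‖ ^ 2) :=
        (ofReal_integral_eq_lintegral_ofReal hSint
          (Eventually.of_forall fun x => by positivity)).symm
    _ = ‖∫ x, ∫ p, Φ x p‖ₑ := by
        simp only [← hS]
        rw [integral_complex_ofReal, ← ofReal_norm, Complex.norm_real, Real.norm_eq_abs, abs_of_nonneg]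
        exact integral_nonneg fun x => by positivity
    _ = ‖∫ p, ∫ x, Φ x p‖ₑ := by rw [integral_integral_swap hΦint]
    _ ≤ ∫⁻ p, ‖∫ x, Φ x p‖ₑ := enorm_integral_le_lintegral_enorm _
    _ = _ := lintegral_congr hG

lemma lintegral_gaussianPDFReal_comp_sq_mul_abs_le {v : NNReal} (hv : v ≠ 0) (a : ℝ) {c : ℝ}
    (hc : 0 < c) :
    ∫⁻ s : ℝ, ENNReal.ofReal (gaussianPDFReal 0 v (a + c * s ^ 2) * |s|) ≤
      ENNReal.ofReal (1 / c) := by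
  set g : ℝ → ℝ≥0∞ := fun u => ENNReal.ofReal (gaussianPDFReal 0 v u) with hg
  have hg1 : ∫⁻ u, g u = 1 := lintegral_gaussianPDFReal_eq_one 0 hv
  have hpiece : ∀ S : Set ℝ, MeasurableSet S → Set.InjOn (fun s : ℝ => a + c * s ^ 2) S →
      ∫⁻ s in S, ENNReal.ofReal |c * (2 * s)| * g (a + c * s ^ 2) ≤ 1 := fun S hS hinj => by
    rw [← lintegral_image_eq_lintegral_abs_deriv_mul hS (f := fun s : ℝ => a + c * s ^ 2)
      (f' := fun s => c * (2 * s)) (fun x _ => ?_) hinj g, ← hg1]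
    · exact setLIntegral_le_lintegral _ _
    · have := (((hasDerivAt_pow 2 x).const_mul c).const_add a).hasDerivWithinAt (s := S)
      simpa using this
  have hpt : ∀ s : ℝ, ENNReal.ofReal (gaussianPDFReal 0 v (a + c * s ^ 2) * |s|) =
      ENNReal.ofReal (1 / (2 * c)) * (ENNReal.ofReal |c * (2 * s)| * g (a + c * s ^ 2)) := by
    intro s
    rw [hg, ← ENNReal.ofReal_mul (by positivity), ← ENNReal.ofReal_mul (by positivity)]
    congr 1
    rw [abs_mul, abs_mul, abs_of_pos hc, abs_of_pos (two_pos : (0 : ℝ) < 2)]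
    field_simp
  simp only [hpt]
  rw [lintegral_const_mul' _ _ ENNReal.ofReal_ne_top, ← lintegral_add_compl _ measurableSet_Ioi
    (A := Set.Ioi (0 : ℝ)), Set.compl_Ioi, ← setLIntegral_congr Iio_ae_eq_Iic]
  have h1 := hpiece (Set.Ioi 0) measurableSet_Ioi (fun x hx y hy hxy => by
    simp only [Set.mem_Ioi] at hx hy
    have : c * x ^ 2 = c * y ^ 2 := by simpa using hxy
    exact (pow_left_inj₀ hx.le hy.le two_ne_zero).1 (mul_left_cancel₀ hc.ne' this))
  have h2 := hpiece (Set.Iio 0) measurableSet_Iio (fun x hx y hy hxy => by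
    simp only [Set.mem_Iio] at hx hy
    have h3 : c * x ^ 2 = c * y ^ 2 := by simpa using hxy
    have h4 : (-x) ^ 2 = (-y) ^ 2 := by
      rw [neg_sq, neg_sq]; exact mul_left_cancel₀ hc.ne' h3
    exact neg_injective ((pow_left_inj₀ (by linarith) (by linarith) two_ne_zero).1 h4))
  calc _ ≤ ENNReal.ofReal (1 / (2 * c)) * (1 + 1) := by gcongr
    _ = ENNReal.ofReal (1 / (2 * c)) * ENNReal.ofReal 2 := by
        congr 1; rw [one_add_one_eq_two]; simp
    _ = _ := by
        rw [← ENNReal.ofReal_mul (by positivity)]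
        congr 1
        field_simp

lemma lintegral_prod_gaussian_eq_one {m : ℕ} {R : ℝ} (hR : 0 < R) (ζ : Fin m → ℝ) :
    ∫⁻ y : Fin m → ℝ, ENNReal.ofReal
      (∏ j, R * Real.exp (-(Real.pi * R ^ 2) * (ζ j - y j) ^ 2)) = 1 := by
  have hint : ∀ z : ℝ, Integrable fun s : ℝ =>
      R * Real.exp (-(Real.pi * R ^ 2) * (z - s) ^ 2) := fun z =>
    ((integrable_exp_neg_mul_sq (b := Real.pi * R ^ 2) (by positivity)).comp_sub_left z).const_mul R
  have hval : ∀ z : ℝ, ∫ s : ℝ, R * Real.exp (-(Real.pi * R ^ 2) * (z - s) ^ 2) = 1 := fun z => by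
    rw [integral_const_mul,
      integral_sub_left_eq_self (fun s : ℝ => Real.exp (-(Real.pi * R ^ 2) * s ^ 2)) volume z,
      integral_gaussian, show Real.pi / (Real.pi * R ^ 2) = (1 / R) ^ 2 by field_simp,
      Real.sqrt_sq (by positivity)]
    field_simp
  have hI : Integrable fun y : Fin m → ℝ =>
      ∏ j, R * Real.exp (-(Real.pi * R ^ 2) * (ζ j - y j) ^ 2) :=
    Integrable.fintype_prod (f := fun j (s : ℝ) =>
      R * Real.exp (-(Real.pi * R ^ 2) * (ζ j - s) ^ 2)) fun j => hint (ζ j)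
  rw [← ofReal_integral_eq_lintegral_ofReal hI
    (Eventually.of_forall fun y => Finset.prod_nonneg fun j _ => by positivity),
    integral_fintype_prod_volume_eq_prod (fun j (s : ℝ) =>
      R * Real.exp (-(Real.pi * R ^ 2) * (ζ j - s) ^ 2))]
  rw [Finset.prod_eq_one fun j _ => hval (ζ j), ENNReal.ofReal_one]

/-- Thickened spheres `{|η|² ≈ -a/c}`, weighted by `|η_i|`, have mass `O(R)` against normalised
Gaussians of width `1/R`. -/
lemma lintegral_gaussian_mul_thickened_sphere_le {n : ℕ} (i : Fin n) {v : NNReal} (hv : v ≠ 0)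
    (a : ℝ) {c R : ℝ} (hc : 0 < c) (hR : 0 < R) (ξ : EuclideanSpace ℝ (Fin n)) :
    ∫⁻ η : EuclideanSpace ℝ (Fin n),
      ENNReal.ofReal (R ^ n * Real.exp (-(Real.pi * R ^ 2) * ‖ξ - η‖ ^ 2)) *
        ENNReal.ofReal (gaussianPDFReal 0 v (a + c * ‖η‖ ^ 2) * |η i|) ≤
      ENNReal.ofReal (R / c) := by
  obtain _ | m := n
  · exact i.elim0
  set K : (Fin m → ℝ) → ℝ := fun y =>
    ∏ j, R * Real.exp (-(Real.pi * R ^ 2) * (ξ (i.succAbove j) - y j) ^ 2) with hK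
  have hK0 : ∀ y, 0 ≤ K y := fun y => Finset.prod_nonneg fun j _ => by positivity
  set G : ℝ × (Fin m → ℝ) → ℝ≥0∞ := fun p => ENNReal.ofReal (R * K p.2) *
    ENNReal.ofReal (gaussianPDFReal 0 v ((a + c * ∑ j, p.2 j ^ 2) + c * p.1 ^ 2) * |p.1|) with hG
  have hGm : Measurable G := by
    have := measurable_gaussianPDFReal 0 v
    fun_prop
  have hmp : MeasurePreserving (fun η : EuclideanSpace ℝ (Fin (m + 1)) =>
      MeasurableEquiv.piFinSuccAbove (fun _ => ℝ) i (WithLp.ofLp η)) volume volume :=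
    (volume_preserving_piFinSuccAbove (fun _ => ℝ) i).comp (PiLp.volume_preserving_ofLp _)
  have hle : ∀ η : EuclideanSpace ℝ (Fin (m + 1)),
      ENNReal.ofReal (R ^ (m + 1) * Real.exp (-(Real.pi * R ^ 2) * ‖ξ - η‖ ^ 2)) *
        ENNReal.ofReal (gaussianPDFReal 0 v (a + c * ‖η‖ ^ 2) * |η i|) ≤
      G (MeasurableEquiv.piFinSuccAbove (fun _ => ℝ) i (WithLp.ofLp η)) := fun η => by
    have h1 : ‖η‖ ^ 2 = η i ^ 2 + ∑ j, η (i.succAbove j) ^ 2 := by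
      rw [EuclideanSpace.real_norm_sq_eq, Fin.sum_univ_succAbove _ i]
    have h2 : ‖ξ - η‖ ^ 2 = (ξ i - η i) ^ 2 +
        ∑ j, (ξ (i.succAbove j) - η (i.succAbove j)) ^ 2 := by
      rw [EuclideanSpace.real_norm_sq_eq, Fin.sum_univ_succAbove _ i]
      simp
    have h3 : R ^ (m + 1) * Real.exp (-(Real.pi * R ^ 2) * ‖ξ - η‖ ^ 2) ≤
        R * K (fun j => η (i.succAbove j)) := by
      rw [hK]
      simp only [Finset.prod_mul_distrib, Finset.prod_const, Finset.card_univ, Fintype.card_fin,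
        ← Real.exp_sum, ← Finset.mul_sum]
      rw [pow_succ', mul_assoc, h2]
      refine mul_le_mul_of_nonneg_left (mul_le_mul_of_nonneg_left (Real.exp_le_exp.2 ?_)
        (by positivity)) hR.le
      have : 0 ≤ (Real.pi * R ^ 2) * (ξ i - η i) ^ 2 := by positivity
      linarith
    have h4 : a + c * ‖η‖ ^ 2 = (a + c * ∑ j, η (i.succAbove j) ^ 2) + c * η i ^ 2 := by
      rw [h1]; ring
    rw [h4]
    exact mul_le_mul_left (ENNReal.ofReal_le_ofReal h3) _
  calc _ ≤ ∫⁻ η : EuclideanSpace ℝ (Fin (m + 1)),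
        G (MeasurableEquiv.piFinSuccAbove (fun _ => ℝ) i (WithLp.ofLp η)) := lintegral_mono hle
    _ = ∫⁻ p, G p := hmp.lintegral_comp hGm
    _ = ∫⁻ y, ∫⁻ s, G (s, y) := lintegral_prod_symm _ hGm.aemeasurable
    _ ≤ ∫⁻ y, ENNReal.ofReal (R / c) * ENNReal.ofReal (K y) := by
        refine lintegral_mono fun y => ?_
        simp only [hG]
        rw [lintegral_const_mul' _ _ ENNReal.ofReal_ne_top]
        calc _ ≤ ENNReal.ofReal (R * K y) * ENNReal.ofReal (1 / c) := by
              gcongr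
              exact lintegral_gaussianPDFReal_comp_sq_mul_abs_le hv _ hc
          _ = _ := by
              rw [← ENNReal.ofReal_mul (mul_nonneg hR.le (hK0 y)),
                ← ENNReal.ofReal_mul (by positivity)]
              congr 1
              ring
    _ = _ := by
        rw [lintegral_const_mul' _ _ ENNReal.ofReal_ne_top, lintegral_prod_gaussian_eq_one hR,
          mul_one]

lemma lintegral_gaussianPDFReal_mul_one_add_sq {v : NNReal} (hv : v ≠ 0) :
    ∫⁻ s : ℝ, ENNReal.ofReal (gaussianPDFReal 0 v s * (1 + s ^ 2)) = 1 + v := by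
  have h1 : ∫⁻ s, ‖s‖ₑ ^ 2 ∂(gaussianReal 0 v) = v := by
    have h2 : MemLp (id : ℝ → ℝ) 2 (gaussianReal 0 v) := memLp_id_gaussianReal 2
    have h3 := h2.ofReal_variance_eq
    rw [variance_id_gaussianReal, evariance] at h3
    simp only [id, integral_id_gaussianReal, sub_zero, ENNReal.ofReal_coe_nnreal] at h3
    exact h3.symm
  have h4 : ∫⁻ s, (1 + ‖s‖ₑ ^ 2) ∂(gaussianReal 0 v) = 1 + v := by
    rw [lintegral_add_left measurable_const, h1]
    simp
  rw [← h4, gaussianReal_of_var_ne_zero _ hv, lintegral_withDensity_eq_lintegral_mul _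
    (measurable_gaussianPDF 0 v) (by fun_prop)]
  refine lintegral_congr fun s => ?_
  rw [ENNReal.ofReal_mul (gaussianPDFReal_nonneg _ _ _), Pi.mul_apply, gaussianPDF]
  congr 1
  rw [ENNReal.ofReal_add zero_le_one (sq_nonneg s), ENNReal.ofReal_one, ← sq_abs,
    ENNReal.ofReal_pow (abs_nonneg s), ← Real.enorm_eq_ofReal_abs]

/-- Mollification essentially preserves the weight `(1 + λ²)^{-1/4}`. -/
lemma lintegral_weight_mul_gaussian_le {v : NNReal} (hv : v ≠ 0) (hv1 : v ≤ 1) (a : ℝ) :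
    ∫⁻ lam : ℝ, ENNReal.ofReal ((1 + lam ^ 2) ^ (-(1 : ℝ) / 4)) *
      ENNReal.ofReal (gaussianPDFReal 0 v (lam + a)) ≤
      4 * ENNReal.ofReal ((1 + a ^ 2) ^ (-(1 : ℝ) / 4)) := by
  have hpt : ∀ lam : ℝ, (1 + lam ^ 2) ^ (-(1 : ℝ) / 4) ≤
      (1 + a ^ 2) ^ (-(1 : ℝ) / 4) * (2 * (1 + (lam + a) ^ 2)) := fun lam => by
    have e1 : 1 + a ^ 2 ≤ (2 * (1 + (lam + a) ^ 2)) * (1 + lam ^ 2) := by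
      nlinarith [sq_nonneg (2 * lam + a), mul_nonneg (sq_nonneg (lam + a)) (sq_nonneg lam)]
    have e2 : (1 + a ^ 2) ^ ((1 : ℝ) / 4) ≤
        (2 * (1 + (lam + a) ^ 2)) * (1 + lam ^ 2) ^ ((1 : ℝ) / 4) := by
      calc _ ≤ ((2 * (1 + (lam + a) ^ 2)) * (1 + lam ^ 2)) ^ ((1 : ℝ) / 4) :=
            Real.rpow_le_rpow (by positivity) e1 (by norm_num)
        _ = (2 * (1 + (lam + a) ^ 2)) ^ ((1 : ℝ) / 4) * (1 + lam ^ 2) ^ ((1 : ℝ) / 4) :=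
            Real.mul_rpow (by positivity) (by positivity)
        _ ≤ _ := by
            gcongr
            refine (Real.rpow_le_rpow_of_exponent_le (y := 1 / 4) (z := 1) ?_ (by norm_num)).trans_eq
              (Real.rpow_one _)
            nlinarith [sq_nonneg (lam + a)]
    rw [neg_div, Real.rpow_neg (by positivity), Real.rpow_neg (by positivity)]
    rw [inv_mul_eq_div, le_div_iff₀ (by positivity), inv_mul_le_iff₀ (by positivity), mul_comm]
    exact e2
  calc _ ≤ ∫⁻ lam : ℝ, ENNReal.ofReal ((1 + a ^ 2) ^ (-(1 : ℝ) / 4) * 2) *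
        ENNReal.ofReal (gaussianPDFReal 0 v (lam + a) * (1 + (lam + a) ^ 2)) := by
        refine lintegral_mono fun lam => ?_
        rw [← ENNReal.ofReal_mul (by positivity), ← ENNReal.ofReal_mul (by positivity)]
        refine ENNReal.ofReal_le_ofReal ?_
        have := mul_le_mul_of_nonneg_right (hpt lam) (gaussianPDFReal_nonneg 0 v (lam + a))
        linarith
    _ = ENNReal.ofReal ((1 + a ^ 2) ^ (-(1 : ℝ) / 4) * 2) * (1 + v) := by
        rw [lintegral_const_mul' _ _ ENNReal.ofReal_ne_top, lintegral_add_right_eq_self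
          (fun s => ENNReal.ofReal (gaussianPDFReal 0 v s * (1 + s ^ 2))),
          lintegral_gaussianPDFReal_mul_one_add_sq hv]
    _ ≤ ENNReal.ofReal ((1 + a ^ 2) ^ (-(1 : ℝ) / 4) * 2) * (1 + 1) := by
        gcongr
        exact_mod_cast hv1
    _ = _ := by
        rw [ENNReal.ofReal_mul (by positivity), mul_comm (4 : ℝ≥0∞), mul_assoc]
        congr 1
        norm_num

lemma abs_mul_weight_le_one {n : ℕ} (i : Fin n) (ξ : EuclideanSpace ℝ (Fin n)) :
    |ξ i| * (1 + (4 * Real.pi ^ 2 * ‖ξ‖ ^ 2) ^ 2) ^ (-(1 : ℝ) / 4) ≤ 1 := by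
  rw [neg_div, Real.rpow_neg (by positivity), ← div_eq_mul_inv, div_le_one (by positivity)]
  refine (PiLp.norm_apply_le ξ i).trans ?_
  have h1 : ‖ξ‖ = (‖ξ‖ ^ 4) ^ ((1 : ℝ) / 4) := by
    rw [← Real.rpow_natCast, ← Real.rpow_mul (norm_nonneg _)]
    norm_num
  conv_lhs => rw [h1]
  refine Real.rpow_le_rpow (by positivity) ?_ (by norm_num)
  have h2 : 1 ≤ 4 * Real.pi ^ 2 := by nlinarith [Real.pi_gt_three]
  have h3 : (1 : ℝ) ≤ (4 * Real.pi ^ 2) ^ 2 := by nlinarith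
  have h4 : 0 ≤ ‖ξ‖ ^ 4 := by positivity
  nlinarith

/-- Symmetric kernels with bounded weighted marginals act boundedly on products. -/
lemma lintegral_prod_symm_kernel_le {V : Type*} [MeasurableSpace V] {μ : Measure V} [SFinite μ]
    {K : V → V → ℝ≥0∞} (hK : Measurable (Function.uncurry K)) (hsymm : ∀ x y, K x y = K y x)
    {q g : V → ℝ≥0∞} (hq : Measurable q) (hg : Measurable g) {B : ℝ≥0∞}
    (hB : ∀ x, ∫⁻ y, K x y * q y ∂μ ≤ B) :
    ∫⁻ p : V × V, K p.1 p.2 * ((q p.1 * g p.1) * (q p.2 * g p.2)) ∂(μ.prod μ) ≤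
      2 * (B * ∫⁻ x, q x * g x ^ 2 ∂μ) := by
  have hK' : Measurable fun p : V × V => K p.1 p.2 := hK
  have hhalf : ∫⁻ p : V × V, (q p.1 * g p.1 ^ 2) * (K p.1 p.2 * q p.2) ∂(μ.prod μ) ≤
      B * ∫⁻ x, q x * g x ^ 2 ∂μ := by
    rw [lintegral_prod _ (by fun_prop)]
    calc _ ≤ ∫⁻ x, B * (q x * g x ^ 2) ∂μ := by
          refine lintegral_mono fun x => ?_
          have hKx : Measurable fun y => K x y := hK.of_uncurry_left
          simp only
          rw [lintegral_const_mul _ (by fun_prop), mul_comm B]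
          gcongr
          exact hB x
      _ = _ := lintegral_const_mul _ (by fun_prop)
  have hswap : ∫⁻ p : V × V, (q p.2 * g p.2 ^ 2) * (K p.1 p.2 * q p.1) ∂(μ.prod μ) =
      ∫⁻ p : V × V, (q p.1 * g p.1 ^ 2) * (K p.1 p.2 * q p.2) ∂(μ.prod μ) := by
    rw [← lintegral_prod_swap]
    refine lintegral_congr fun p => ?_
    simp only [Prod.fst_swap, Prod.snd_swap]
    rw [hsymm]
  calc _ ≤ ∫⁻ p : V × V, ((q p.1 * g p.1 ^ 2) * (K p.1 p.2 * q p.2) +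
        (q p.2 * g p.2 ^ 2) * (K p.1 p.2 * q p.1)) ∂(μ.prod μ) := by
        refine lintegral_mono fun p => ?_
        have h : g p.1 * g p.2 ≤ g p.1 ^ 2 + g p.2 ^ 2 := by
          rcases le_total (g p.1) (g p.2) with h | h
          · exact (mul_le_mul_left h _).trans (by rw [sq (g p.2)]; exact le_add_self)
          · exact (mul_le_mul_right h _).trans (by rw [sq (g p.1)]; exact le_self_add)
        calc _ = K p.1 p.2 * (q p.1 * q p.2) * (g p.1 * g p.2) := by ring
          _ ≤ K p.1 p.2 * (q p.1 * q p.2) * (g p.1 ^ 2 + g p.2 ^ 2) := by gcongr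
          _ = _ := by ring
    _ ≤ _ := by
        rw [lintegral_add_left (by fun_prop), hswap, two_mul]
        gcongr

lemma integrable_gaussian_mul_coord_mul {n : ℕ} (v : NNReal) (i : Fin n)
    (φ : 𝓢(EuclideanSpace ℝ (Fin n), ℂ)) (lam : ℝ) :
    Integrable fun ξ : EuclideanSpace ℝ (Fin n) =>
      ((gaussianPDFReal 0 v (lam + 4 * Real.pi ^ 2 * ‖ξ‖ ^ 2) * ξ i : ℝ) : ℂ) * φ ξ := by
  have hm := measurable_gaussianPDFReal 0 v
  refine ((φ.integrable_pow_mul volume 1).const_mul (√(2 * Real.pi * v))⁻¹).mono'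
    (by fun_prop) (Eventually.of_forall fun ξ => ?_)
  rw [norm_mul, Complex.norm_real, norm_mul, pow_one, mul_assoc]
  gcongr
  · rw [Real.norm_of_nonneg (gaussianPDFReal_nonneg _ _ _), gaussianPDFReal]
    refine mul_le_of_le_one_right (by positivity) (Real.exp_le_one_iff.2 ?_)
    rw [neg_div]
    exact neg_nonpos.2 (by positivity)
  · exact PiLp.norm_apply_le ξ i

lemma lintegral_weight_mollifiedWave_le {n : ℕ} {v : NNReal} (hv : v ≠ 0) (hv1 : v ≤ 1)
    (i : Fin n) (φ : 𝓢(EuclideanSpace ℝ (Fin n), ℂ)) {R : ℝ} (hR : 0 < R) :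
    ∫⁻ lam : ℝ, ENNReal.ofReal ((1 + lam ^ 2) ^ (-(1 : ℝ) / 4)) *
      ∫⁻ x : EuclideanSpace ℝ (Fin n), ENNReal.ofReal (Real.exp (-(Real.pi / R ^ 2) * ‖x‖ ^ 2)) *
        ‖mollifiedWave v i φ x lam‖ₑ ^ 2 ≤
    8 * ENNReal.ofReal R * ∫⁻ ξ, ‖φ ξ‖ₑ ^ 2 := by
  have hm := measurable_gaussianPDFReal 0 v
  have hφ : Measurable φ := φ.continuous.measurable
  set c : ℝ := 4 * Real.pi ^ 2 with hc
  have hc0 : 0 < c := by positivity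
  set q : ℝ → EuclideanSpace ℝ (Fin n) → ℝ≥0∞ := fun lam ξ =>
    ENNReal.ofReal (gaussianPDFReal 0 v (lam + c * ‖ξ‖ ^ 2) * |ξ i|) with hq
  have hqm : Measurable (Function.uncurry q) := by
    simp only [hq, Function.uncurry_def]
    fun_prop
  have hstep : ∀ lam : ℝ, ∫⁻ x : EuclideanSpace ℝ (Fin n),
      ENNReal.ofReal (Real.exp (-(Real.pi / R ^ 2) * ‖x‖ ^ 2)) *
        ‖mollifiedWave v i φ x lam‖ₑ ^ 2 ≤
      2 * (ENNReal.ofReal (R / c) * ∫⁻ ξ, q lam ξ * ‖φ ξ‖ₑ ^ 2) := fun lam => by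
    refine (lintegral_gaussian_mul_enorm_sq_le
      (integrable_gaussian_mul_coord_mul v i φ lam) hR).trans ?_
    rw [finrank_euclideanSpace_fin]
    have henorm : ∀ ξ, ‖((gaussianPDFReal 0 v (lam + 4 * Real.pi ^ 2 * ‖ξ‖ ^ 2) * ξ i : ℝ) : ℂ) *
        φ ξ‖ₑ = q lam ξ * ‖φ ξ‖ₑ := fun ξ => by
      rw [enorm_mul, ← ofReal_norm, Complex.norm_real, norm_mul,
        Real.norm_of_nonneg (gaussianPDFReal_nonneg _ _ _), Real.norm_eq_abs]
    simp only [henorm]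
    exact lintegral_prod_symm_kernel_le (μ := volume)
      (K := fun x y => ENNReal.ofReal (R ^ n * Real.exp (-(Real.pi * R ^ 2) * ‖x - y‖ ^ 2)))
      (by simp only [Function.uncurry_def]; fun_prop) (fun x y => by rw [norm_sub_rev])
      hqm.of_uncurry_left (by fun_prop)
      (lintegral_gaussian_mul_thickened_sphere_le i hv lam hc0 hR)
  calc _ ≤ ∫⁻ lam : ℝ, ∫⁻ ξ, 2 * ENNReal.ofReal (R / c) *
        (ENNReal.ofReal ((1 + lam ^ 2) ^ (-(1 : ℝ) / 4)) * (q lam ξ * ‖φ ξ‖ₑ ^ 2)) := by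
        refine lintegral_mono fun lam => ?_
        have hqm' : Measurable (q lam) := hqm.of_uncurry_left
        rw [lintegral_const_mul _ (by fun_prop), lintegral_const_mul _ (by fun_prop)]
        refine (mul_le_mul_right (hstep lam) _).trans_eq ?_
        ring
    _ = ∫⁻ ξ, ∫⁻ lam : ℝ, 2 * ENNReal.ofReal (R / c) *
        (ENNReal.ofReal ((1 + lam ^ 2) ^ (-(1 : ℝ) / 4)) * (q lam ξ * ‖φ ξ‖ₑ ^ 2)) := by
        refine lintegral_lintegral_swap ?_
        simp only [hq, Function.uncurry_def]
        fun_prop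
    _ ≤ ∫⁻ ξ, 2 * ENNReal.ofReal (R / c) * (4 * ‖φ ξ‖ₑ ^ 2) := by
        refine lintegral_mono fun ξ => ?_
        simp only
        rw [lintegral_const_mul' _ _ (ENNReal.mul_ne_top (by simp) (by simp))]
        gcongr
        calc _ = ∫⁻ lam : ℝ, (ENNReal.ofReal |ξ i| * ‖φ ξ‖ₑ ^ 2) *
              (ENNReal.ofReal ((1 + lam ^ 2) ^ (-(1 : ℝ) / 4)) *
                ENNReal.ofReal (gaussianPDFReal 0 v (lam + c * ‖ξ‖ ^ 2))) := by
              refine lintegral_congr fun lam => ?_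
              rw [hq]
              simp only
              rw [ENNReal.ofReal_mul (gaussianPDFReal_nonneg _ _ _)]
              ring
          _ ≤ (ENNReal.ofReal |ξ i| * ‖φ ξ‖ₑ ^ 2) *
              (4 * ENNReal.ofReal ((1 + (c * ‖ξ‖ ^ 2) ^ 2) ^ (-(1 : ℝ) / 4))) := by
              rw [lintegral_const_mul' _ _ (ENNReal.mul_ne_top (by simp) (by simp))]
              gcongr
              exact lintegral_weight_mul_gaussian_le hv hv1 _
          _ = 4 * ‖φ ξ‖ₑ ^ 2 *
              ENNReal.ofReal (|ξ i| * (1 + (c * ‖ξ‖ ^ 2) ^ 2) ^ (-(1 : ℝ) / 4)) := by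
              rw [ENNReal.ofReal_mul (abs_nonneg _)]
              ring
          _ ≤ 4 * ‖φ ξ‖ₑ ^ 2 * 1 := by
              gcongr
              exact ENNReal.ofReal_le_one.2 (abs_mul_weight_le_one i ξ)
          _ = _ := mul_one _
    _ = 8 * ENNReal.ofReal (R / c) * ∫⁻ ξ, ‖φ ξ‖ₑ ^ 2 := by
        rw [lintegral_const_mul _ (by fun_prop), lintegral_const_mul _ (by fun_prop)]
        ring
    _ ≤ _ := by
        gcongr
        exact div_le_self hR.le (by nlinarith [Real.pi_gt_three])

lemma enorm_sum_coord_mul_sq_le {n : ℕ} (a : EuclideanSpace ℝ (Fin n)) (w : Fin n → ℂ) :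
    ‖∑ i, ((a i : ℝ) : ℂ) * w i‖ₑ ^ 2 ≤ n * ‖a‖ₑ ^ 2 * ∑ i, ‖w i‖ₑ ^ 2 := by
  have h := ENNReal.rpow_sum_le_const_mul_sum_rpow (p := 2) Finset.univ
    (fun i => ‖((a i : ℝ) : ℂ) * w i‖ₑ) one_le_two
  norm_num at h
  calc _ ≤ (∑ i, ‖((a i : ℝ) : ℂ) * w i‖ₑ) ^ 2 := by gcongr; exact enorm_sum_le _ _
    _ ≤ n * ∑ i, ‖((a i : ℝ) : ℂ) * w i‖ₑ ^ 2 := by simpa using h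
    _ ≤ n * ∑ i, ‖a‖ₑ ^ 2 * ‖w i‖ₑ ^ 2 := by
        gcongr with i
        rw [enorm_mul, mul_pow]
        gcongr
        rw [← ofReal_norm, ← ofReal_norm, Complex.norm_real]
        exact ENNReal.ofReal_le_ofReal (PiLp.norm_apply_le a i)
    _ = _ := by rw [← Finset.mul_sum, mul_assoc]

lemma measurable_mollifiedWave {n : ℕ} (v : NNReal) (i : Fin n)
    (φ : 𝓢(EuclideanSpace ℝ (Fin n), ℂ)) :
    Measurable fun p : EuclideanSpace ℝ (Fin n) × ℝ => mollifiedWave v i φ p.1 p.2 := by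
  have hm := measurable_gaussianPDFReal 0 v
  have hφ : Measurable φ := φ.continuous.measurable
  have h : Measurable fun q : (EuclideanSpace ℝ (Fin n) × ℝ) × EuclideanSpace ℝ (Fin n) =>
      Complex.exp (2 * Real.pi * Complex.I * ⟪q.1.1, q.2⟫) *
        ((gaussianPDFReal 0 v (q.1.2 + 4 * Real.pi ^ 2 * ‖q.2‖ ^ 2) * q.2 i : ℝ) * φ q.2) := by
    fun_prop
  exact (h.stronglyMeasurable.integral_prod_right' (ν := volume)).measurable

lemma measurableSet_shell (n j : ℕ) : MeasurableSet (shell n j) := by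
  unfold shell
  split_ifs <;> measurability

lemma iUnion_shell (n : ℕ) : ⋃ j, shell n j = Set.univ := by
  refine Set.eq_univ_of_forall fun x => Set.mem_iUnion.2 ?_
  obtain ⟨j, hj⟩ := pow_unbounded_of_one_lt ‖x‖ (one_lt_two : (1 : ℝ) < 2)
  classical
  have hex : ∃ j : ℕ, ‖x‖ ≤ (2 : ℝ) ^ j := ⟨j, hj.le⟩
  refine ⟨Nat.find hex, ?_⟩
  have hspec := Nat.find_spec hex
  unfold shell
  split_ifs with h0
  · rw [h0, pow_zero] at hspec
    exact hspec
  · exact ⟨not_le.1 (Nat.find_min hex (Nat.sub_one_lt h0)), hspec⟩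

lemma norm_le_of_mem_shell {n j : ℕ} {x : EuclideanSpace ℝ (Fin n)} (hx : x ∈ shell n j) :
    ‖x‖ ≤ 2 ^ j := by
  unfold shell at hx
  split_ifs at hx with h
  · simpa [h] using hx
  · exact hx.2

/-- A function whose mass on Gaussian balls of radius `R` is `O(R)` integrates against
`⟨x⟩² |A(x)|²` with a bound by `‖A‖²_X`. -/
lemma lintegral_weight_mul_enorm_sq_le {n : ℕ}
    (A : EuclideanSpace ℝ (Fin n) → EuclideanSpace ℝ (Fin n))
    {g : EuclideanSpace ℝ (Fin n) → ℝ≥0∞} (hgm : Measurable g) {B : ℝ≥0∞}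
    (hg : ∀ R : ℝ, 0 < R → ∫⁻ x, ENNReal.ofReal (Real.exp (-(Real.pi / R ^ 2) * ‖x‖ ^ 2)) * g x ≤
      ENNReal.ofReal R * B) :
    ∫⁻ x, ENNReal.ofReal (1 + ‖x‖ ^ 2) * (‖A x‖ₑ ^ 2 * g x) ≤
      ENNReal.ofReal (2 * Real.exp Real.pi) * B * XnormV A ^ 2 := by
  have hX : XnormV A ^ 2 = ∑' j : ℕ, (2 : ℝ≥0∞) ^ (3 * j) *
      (eLpNorm A ⊤ (volume.restrict (shell n j))) ^ 2 := by
    rw [XnormV, ← ENNReal.rpow_natCast, ← ENNReal.rpow_mul]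
    norm_num
  rw [hX, ← setLIntegral_univ, ← iUnion_shell, ← ENNReal.tsum_mul_left]
  refine (lintegral_iUnion_le _ _).trans (ENNReal.tsum_le_tsum fun j => ?_)
  set a := eLpNorm A ⊤ (volume.restrict (shell n j)) with ha
  set R : ℝ := 2 ^ j with hR
  have hR1 : 1 ≤ R := one_le_pow₀ one_le_two
  have hR0 : 0 < R := by positivity
  have hA : ∀ᵐ x ∂(volume.restrict (shell n j)), ‖A x‖ₑ ≤ a := by
    rw [ha, eLpNorm_exponent_top]
    exact ae_le_eLpNormEssSup
  calc _ ≤ ∫⁻ x in shell n j, (ENNReal.ofReal (2 * Real.exp Real.pi * R ^ 2) * a ^ 2) *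
        (ENNReal.ofReal (Real.exp (-(Real.pi / R ^ 2) * ‖x‖ ^ 2)) * g x) := by
        refine lintegral_mono_ae ?_
        filter_upwards [hA, ae_restrict_mem (measurableSet_shell n j)] with x hx hxs
        have hxR : ‖x‖ ≤ R := norm_le_of_mem_shell hxs
        have hxR2 : ‖x‖ ^ 2 ≤ R ^ 2 := by gcongr
        have h1 : 1 + ‖x‖ ^ 2 ≤ 2 * Real.exp Real.pi * R ^ 2 *
            Real.exp (-(Real.pi / R ^ 2) * ‖x‖ ^ 2) := by
          have h2 : 1 ≤ Real.exp Real.pi * Real.exp (-(Real.pi / R ^ 2) * ‖x‖ ^ 2) := by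
            rw [← Real.exp_add, Real.one_le_exp_iff]
            have : Real.pi / R ^ 2 * ‖x‖ ^ 2 ≤ Real.pi := by
              rw [div_mul_eq_mul_div, div_le_iff₀ (by positivity)]
              gcongr
            linarith
          have h3 : 1 ≤ R ^ 2 := one_le_pow₀ hR1
          nlinarith
        calc _ ≤ ENNReal.ofReal (2 * Real.exp Real.pi * R ^ 2 *
              Real.exp (-(Real.pi / R ^ 2) * ‖x‖ ^ 2)) * (a ^ 2 * g x) := by gcongr
          _ = _ := by
              rw [ENNReal.ofReal_mul (by positivity)]
              ring
    _ ≤ ∫⁻ x, (ENNReal.ofReal (2 * Real.exp Real.pi * R ^ 2) * a ^ 2) *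
        (ENNReal.ofReal (Real.exp (-(Real.pi / R ^ 2) * ‖x‖ ^ 2)) * g x) :=
        setLIntegral_le_lintegral _ _
    _ ≤ (ENNReal.ofReal (2 * Real.exp Real.pi * R ^ 2) * a ^ 2) * (ENNReal.ofReal R * B) := by
        rw [lintegral_const_mul _ (by fun_prop)]
        gcongr
        exact hg R hR0
    _ = ENNReal.ofReal (2 * Real.exp Real.pi) * B * (ENNReal.ofReal R ^ 3 * a ^ 2) := by
        rw [ENNReal.ofReal_mul (by positivity), ENNReal.ofReal_pow hR0.le]
        ring
    _ = _ := by
        rw [hR, ENNReal.ofReal_pow zero_le_two, ENNReal.ofReal_ofNat, ← pow_mul, mul_comm j]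

lemma lintegral_enorm_fourier_sq {n : ℕ} (f : 𝓢(EuclideanSpace ℝ (Fin n), ℂ)) :
    ∫⁻ ξ, ‖(FourierTransform.fourier f : 𝓢(EuclideanSpace ℝ (Fin n), ℂ)) ξ‖ₑ ^ 2 =
      eLpNorm f 2 volume ^ 2 := by
  have h : ∀ g : 𝓢(EuclideanSpace ℝ (Fin n), ℂ),
      ∫⁻ ξ, ‖g ξ‖ₑ ^ 2 = ENNReal.ofReal (∫ ξ, ‖g ξ‖ ^ 2) := fun g => by
    rw [ofReal_integral_eq_lintegral_ofReal (μ := volume)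
      ((memLp_two_iff_integrable_sq_norm g.continuous.aestronglyMeasurable).1 (g.memLp 2 volume))
      (Eventually.of_forall fun ξ => by positivity)]
    refine lintegral_congr fun ξ => ?_
    rw [ENNReal.ofReal_pow (norm_nonneg _), ofReal_norm]
  have h2 := eLpNorm_nnreal_pow_eq_lintegral (f := f) (μ := volume) (p := 2) two_ne_zero
  norm_num at h2
  rw [h2, h, h, SchwartzMap.integral_norm_sq_fourier]

/-- The spectral density of the square of the `H^{-1/4}` norm of the regularised gradient wave. -/
noncomputable def mollifiedEnergy {n : ℕ} (v : NNReal) (φ : EuclideanSpace ℝ (Fin n) → ℂ)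
    (x : EuclideanSpace ℝ (Fin n)) (lam : ℝ) : ℝ≥0∞ :=
  ENNReal.ofReal ((1 + lam ^ 2) ^ (-(1 : ℝ) / 4)) * ∑ i, ‖mollifiedWave v i φ x lam‖ₑ ^ 2

lemma measurable_mollifiedEnergy {n : ℕ} (v : NNReal) (φ : 𝓢(EuclideanSpace ℝ (Fin n), ℂ)) :
    Measurable (Function.uncurry (mollifiedEnergy v φ)) := by
  have h := fun i => measurable_mollifiedWave v i φ
  simp only [Function.uncurry_def, mollifiedEnergy]
  refine Measurable.mul (by fun_prop) (Finset.measurable_fun_sum _ fun i _ => ?_)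
  exact (h i).enorm.pow_const 2

lemma lintegral_gaussian_mul_mollifiedEnergy_le {n : ℕ} {v : NNReal} (hv : v ≠ 0) (hv1 : v ≤ 1)
    (φ : 𝓢(EuclideanSpace ℝ (Fin n), ℂ)) {R : ℝ} (hR : 0 < R) :
    ∫⁻ x, ENNReal.ofReal (Real.exp (-(Real.pi / R ^ 2) * ‖x‖ ^ 2)) *
      ∫⁻ lam, mollifiedEnergy v φ x lam ≤
    ENNReal.ofReal R * (n * 8 * ∫⁻ ξ, ‖φ ξ‖ₑ ^ 2) := by
  set G : EuclideanSpace ℝ (Fin n) → ℝ≥0∞ := fun x =>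
    ENNReal.ofReal (Real.exp (-(Real.pi / R ^ 2) * ‖x‖ ^ 2)) with hG
  set w : ℝ → ℝ≥0∞ := fun lam => ENNReal.ofReal ((1 + lam ^ 2) ^ (-(1 : ℝ) / 4)) with hw
  set W : Fin n → EuclideanSpace ℝ (Fin n) → ℝ → ℝ≥0∞ := fun i x lam =>
    ‖mollifiedWave v i φ x lam‖ₑ ^ 2 with hW
  have hGm : Measurable G := by fun_prop
  have hwm : Measurable w := by fun_prop
  have hWm : ∀ i, Measurable (Function.uncurry (W i)) := fun i =>
    (measurable_mollifiedWave v i φ).enorm.pow_const 2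
  have hbound : ∀ i, ∫⁻ lam, w lam * ∫⁻ x, G x * W i x lam ≤
      8 * ENNReal.ofReal R * ∫⁻ ξ, ‖φ ξ‖ₑ ^ 2 := fun i =>
    lintegral_weight_mollifiedWave_le hv hv1 i φ hR
  change ∫⁻ x, G x * ∫⁻ lam, w lam * ∑ i, W i x lam ≤ _
  clear_value G w W
  have hGW : ∀ i, Measurable fun p : EuclideanSpace ℝ (Fin n) × ℝ =>
      G p.1 * (w p.2 * W i p.1 p.2) := fun i =>
    (hGm.comp measurable_fst).mul ((hwm.comp measurable_snd).mul (hWm i))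
  calc ∫⁻ x, G x * ∫⁻ lam, w lam * ∑ i, W i x lam
      = ∫⁻ x, ∑ i, ∫⁻ lam, G x * (w lam * W i x lam) := by
        refine lintegral_congr fun x => ?_
        have hWx : ∀ i, Measurable (W i x) := fun i => (hWm i).of_uncurry_left
        rw [← lintegral_finsetSum _ fun i _ => by fun_prop, ← lintegral_const_mul _ (by fun_prop)]
        simp only [Finset.mul_sum]
    _ = ∑ i, ∫⁻ x, ∫⁻ lam, G x * (w lam * W i x lam) :=
        lintegral_finsetSum _ fun i _ => (hGW i).lintegral_prod_right'
    _ ≤ ∑ _i : Fin n, 8 * ENNReal.ofReal R * ∫⁻ ξ, ‖φ ξ‖ₑ ^ 2 := by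
        refine Finset.sum_le_sum fun i _ => ?_
        rw [lintegral_lintegral_swap (hGW i).aemeasurable]
        refine le_of_eq_of_le (lintegral_congr fun lam => ?_) (hbound i)
        have hWlam : Measurable fun x => W i x lam := (hWm i).of_uncurry_right
        rw [← lintegral_const_mul _ (by fun_prop)]
        exact lintegral_congr fun x => by ring
    _ = _ := by
        rw [Finset.sum_const, Finset.card_univ, Fintype.card_fin, nsmul_eq_mul]
        ring

lemma HnormSq_gradient_term_le_liminf {n : ℕ} (a : EuclideanSpace ℝ (Fin n))
    (f : 𝓢(EuclideanSpace ℝ (Fin n), ℂ)) (x : EuclideanSpace ℝ (Fin n)) {v : ℕ → NNReal}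
    (hv : Tendsto v atTop (𝓝 0)) (hv0 : ∀ k, v k ≠ 0) :
    HnormSq (-(1 : ℝ) / 4) (fun t => ∑ i : Fin n, ((a i : ℝ) : ℂ) *
      fderiv ℝ (fun y => schrod n t f y) x (EuclideanSpace.single i 1)) ≤
    ‖(4 * Real.pi ^ 2 * Complex.I : ℂ)‖ₑ ^ 2 * n * ‖a‖ₑ ^ 2 * liminf (fun k => ∫⁻ lam : ℝ,
      mollifiedEnergy (v k) (FourierTransform.fourier f : 𝓢(EuclideanSpace ℝ (Fin n), ℂ)) x lam)
      atTop := by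
  set φ : 𝓢(EuclideanSpace ℝ (Fin n), ℂ) := FourierTransform.fourier f with hφ
  set D : ℝ≥0∞ := ‖(4 * Real.pi ^ 2 * Complex.I : ℂ)‖ₑ ^ 2 * n * ‖a‖ₑ ^ 2 with hD
  have hD_top : D ≠ ⊤ := by
    refine ENNReal.mul_ne_top (ENNReal.mul_ne_top ?_ (by simp)) ?_ <;>
      exact ENNReal.pow_ne_top enorm_ne_top
  have hreg : ∀ (k : ℕ) (lam : ℝ), ∫ t : ℝ, Complex.exp (-(Complex.I * (t : ℂ) * (lam : ℂ))) *
      Complex.exp (-((v k : ℝ) / 2 : ℂ) * (t : ℂ) ^ 2) * ∑ i : Fin n, ((a i : ℝ) : ℂ) *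
        fderiv ℝ (fun y => schrod n t f y) x (EuclideanSpace.single i 1) =
      (4 * Real.pi ^ 2 * Complex.I) * ∑ i, ((a i : ℝ) : ℂ) * mollifiedWave (v k) i φ x lam := by
    intro k lam
    simp only [Finset.mul_sum, mul_left_comm _ ((a _ : ℝ) : ℂ)]
    rw [integral_finsetSum _ fun i _ =>
      (integrable_regularised_fderiv_schrod f x i lam (hv0 k)).const_mul _]
    refine Finset.sum_congr rfl fun i _ => ?_
    rw [integral_const_mul, integral_regularised_fderiv_schrod f x i lam (hv0 k)]
  have hlam : ∀ lam : ℝ, ENNReal.ofReal ((1 + lam ^ 2) ^ (-(1 : ℝ) / 4)) *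
      ‖∫ t : ℝ, Complex.exp (-(Complex.I * (t : ℂ) * (lam : ℂ))) * ∑ i : Fin n, ((a i : ℝ) : ℂ) *
        fderiv ℝ (fun y => schrod n t f y) x (EuclideanSpace.single i 1)‖ₑ ^ 2 ≤
      D * liminf (fun k => mollifiedEnergy (v k) φ x lam) atTop := fun lam => by
    refine (mul_le_mul_right (enorm_integral_sq_le_liminf _ v hv lam) _).trans ?_
    rw [← ENNReal.liminf_const_mul_of_ne_top ENNReal.ofReal_ne_top,
      ← ENNReal.liminf_const_mul_of_ne_top hD_top]
    refine liminf_le_liminf (Eventually.of_forall fun k => ?_)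
    simp only [hreg]
    rw [mollifiedEnergy, enorm_mul, mul_pow]
    calc _ ≤ ENNReal.ofReal ((1 + lam ^ 2) ^ (-(1 : ℝ) / 4)) *
          (‖(4 * Real.pi ^ 2 * Complex.I : ℂ)‖ₑ ^ 2 *
            (n * ‖a‖ₑ ^ 2 * ∑ i, ‖mollifiedWave (v k) i φ x lam‖ₑ ^ 2)) := by
          gcongr
          exact enorm_sum_coord_mul_sq_le a _
      _ = _ := by
          rw [hD]
          ring
  calc _ ≤ ∫⁻ lam : ℝ, D * liminf (fun k => mollifiedEnergy (v k) φ x lam) atTop :=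
        lintegral_mono hlam
    _ ≤ _ := by
        rw [lintegral_const_mul' _ _ hD_top]
        gcongr
        exact lintegral_liminf_le fun k => (measurable_mollifiedEnergy (v k) φ).of_uncurry_left

end GradientSmoothing

open Filter Topology in
/-- Smoothing estimate for `A·∇ e^{itΔ}` with a quarter time-derivative loss:
`∫ ⟨x⟩² ‖A(x)·∇(e^{itΔ}f)(x)‖²_{H^{-1/4}_t(ℝ)} dx ≲ ‖A‖²_X ‖f‖²_{L²}` for `n ≥ 3`. -/
theorem free_smoothing_gradient_term (n : ℕ) (hn : 3 ≤ n) :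
    ∃ C : ℝ≥0∞, C ≠ ⊤ ∧
      ∀ A : EuclideanSpace ℝ (Fin n) → EuclideanSpace ℝ (Fin n), Continuous A →
        XnormV A ≠ ⊤ →
        ∀ f : 𝓢(EuclideanSpace ℝ (Fin n), ℂ),
          (∫⁻ x : EuclideanSpace ℝ (Fin n),
              ENNReal.ofReal (1 + ‖x‖ ^ 2) *
                HnormSq (-(1 : ℝ) / 4) (fun t =>
                  ∑ i : Fin n, ((A x i : ℝ) : ℂ) *
                    fderiv ℝ (fun y => schrod n t (⇑f) y) x (EuclideanSpace.single i 1)))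
            ≤ C * (XnormV A) ^ 2 * (eLpNorm (⇑f) 2 volume) ^ 2 := by
  refine ⟨‖(4 * Real.pi ^ 2 * Complex.I : ℂ)‖ₑ ^ 2 * n *
    (ENNReal.ofReal (2 * Real.exp Real.pi) * (n * 8)), ?_, fun A hA _ f => ?_⟩
  · refine ENNReal.mul_ne_top (ENNReal.mul_ne_top (ENNReal.pow_ne_top enorm_ne_top) (by simp))
      (ENNReal.mul_ne_top ENNReal.ofReal_ne_top (ENNReal.mul_ne_top (by simp) (by simp)))
  set φ : 𝓢(EuclideanSpace ℝ (Fin n), ℂ) := FourierTransform.fourier f with hφ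
  set D : ℝ≥0∞ := ‖(4 * Real.pi ^ 2 * Complex.I : ℂ)‖ₑ ^ 2 * n with hD
  have hD_top : D ≠ ⊤ := ENNReal.mul_ne_top (ENNReal.pow_ne_top enorm_ne_top) (by simp)
  obtain ⟨v, hv, hv0, hv1⟩ : ∃ v : ℕ → NNReal, Tendsto v atTop (𝓝 0) ∧ (∀ k, v k ≠ 0) ∧
      ∀ k, v k ≤ 1 := by
    refine ⟨fun k => 1 / ((k : NNReal) + 1), tendsto_one_div_add_atTop_nhds_zero_nat, fun k => ?_,
      fun k => ?_⟩
    · positivity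
    · exact div_le_one_of_le₀ (by simp) (by positivity)
  set g : ℕ → EuclideanSpace ℝ (Fin n) → ℝ≥0∞ := fun k x => ∫⁻ lam, mollifiedEnergy (v k) φ x lam
    with hg
  have hgm : ∀ k, Measurable (g k) := fun k =>
    (measurable_mollifiedEnergy (v k) φ).lintegral_prod_right
  have hA' := hA.measurable
  have hpt : ∀ x, ENNReal.ofReal (1 + ‖x‖ ^ 2) * HnormSq (-(1 : ℝ) / 4) (fun t =>
      ∑ i : Fin n, ((A x i : ℝ) : ℂ) *
        fderiv ℝ (fun y => schrod n t (⇑f) y) x (EuclideanSpace.single i 1)) ≤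
      D * liminf (fun k => ENNReal.ofReal (1 + ‖x‖ ^ 2) * (‖A x‖ₑ ^ 2 * g k x)) atTop := fun x => by
    rw [ENNReal.liminf_const_mul_of_ne_top ENNReal.ofReal_ne_top,
      ENNReal.liminf_const_mul_of_ne_top (ENNReal.pow_ne_top enorm_ne_top)]
    refine (mul_le_mul_right (HnormSq_gradient_term_le_liminf (A x) f x hv hv0) _).trans_eq ?_
    ring
  calc _ ≤ ∫⁻ x, D *
        liminf (fun k => ENNReal.ofReal (1 + ‖x‖ ^ 2) * (‖A x‖ₑ ^ 2 * g k x)) atTop :=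
        lintegral_mono hpt
    _ ≤ D * liminf (fun k => ∫⁻ x, ENNReal.ofReal (1 + ‖x‖ ^ 2) * (‖A x‖ₑ ^ 2 * g k x)) atTop := by
        rw [lintegral_const_mul' _ _ hD_top]
        gcongr
        exact lintegral_liminf_le fun k => by
          have := hgm k
          fun_prop
    _ ≤ D * (ENNReal.ofReal (2 * Real.exp Real.pi) * (n * 8 * ∫⁻ ξ, ‖φ ξ‖ₑ ^ 2) *
        XnormV A ^ 2) := by
        gcongr
        refine liminf_le_of_frequently_le' (Frequently.of_forall fun k => ?_)
        exact lintegral_weight_mul_enorm_sq_le A (hgm k) fun R hR =>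
          lintegral_gaussian_mul_mollifiedEnergy_le (hv0 k) (hv1 k) φ hR
    _ = _ := by
        rw [hφ, lintegral_enorm_fourier_sq]
        ring
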